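/- Let a ∈ ℝ and let J, y : ℝ → ℝ³ be differentiable curves with y₁(u), y₂(u), y₃(u) ≠ 0 for all u, satisfying dJ/du = (a²/2)(y × y⁻¹) and dy/du = −(1/2)(J × y⁻¹), where y⁻¹ = (1/y₁, 1/y₂, 1/y₃). Then the Hamiltonian H(u) = J₁(u)² + J₂(u)² + J₃(u)² − a² ( y₁(u)² + y₂(u)² + y₃(u)² ) is constant in u. -/

import Mathlib

/-- The cross product in `ℝ³`. -/
def cross (u v : Fin 3 → ℝ) : Fin 3 → ℝ :=
  ![u 1 * v 2 - u 2 * v 1, u 2 * v 0 - u 0 * v 2, u 0 * v 1 - u 1 * v 0]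

/-- Along the flow `dJ/du = (a²/2)(y × y⁻¹)`, `dy/du = −(1/2)(J × y⁻¹)` of the
deformed spherical top (with `y₁,y₂,y₃ ≠ 0`), the Hamiltonian
`H = J₁² + J₂² + J₃² − a²(y₁² + y₂² + y₃²)` is constant in `u`. -/
theorem deformed_top_hamiltonian_conserved (a : ℝ)
    (J y : ℝ → Fin 3 → ℝ)
    (hy0 : ∀ u, y u 0 ≠ 0 ∧ y u 1 ≠ 0 ∧ y u 2 ≠ 0)
    (hJ : ∀ u, HasDerivAt J ((a ^ 2 / 2) • cross (y u) (fun i => (y u i)⁻¹)) u)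
    (hy : ∀ u, HasDerivAt y (-((1 : ℝ) / 2) • cross (J u) (fun i => (y u i)⁻¹)) u) :
    ∀ u₁ u₂ : ℝ,
      J u₁ 0 ^ 2 + J u₁ 1 ^ 2 + J u₁ 2 ^ 2
          - a ^ 2 * (y u₁ 0 ^ 2 + y u₁ 1 ^ 2 + y u₁ 2 ^ 2) =
        J u₂ 0 ^ 2 + J u₂ 1 ^ 2 + J u₂ 2 ^ 2
          - a ^ 2 * (y u₂ 0 ^ 2 + y u₂ 1 ^ 2 + y u₂ 2 ^ 2) := by
  have hJi := fun u => hasDerivAt_pi.1 (hJ u)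
  have hyi := fun u => hasDerivAt_pi.1 (hy u)
  have key : ∀ u, HasDerivAt (fun u => J u 0 ^ 2 + J u 1 ^ 2 + J u 2 ^ 2
          - a ^ 2 * (y u 0 ^ 2 + y u 1 ^ 2 + y u 2 ^ 2)) 0 u := by
    intro u
    have h := ((((hJi u 0).fun_pow 2).fun_add ((hJi u 1).fun_pow 2)).fun_add
      ((hJi u 2).fun_pow 2)).fun_sub
      (((((hyi u 0).fun_pow 2).fun_add ((hyi u 1).fun_pow 2)).fun_add
      ((hyi u 2).fun_pow 2)).const_mul (a ^ 2))
    refine h.congr_deriv ?_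
    simp [cross]
    ring
  intro u₁ u₂
  exact is_const_of_deriv_eq_zero (fun u => (key u).differentiableAt)
    (fun u => (key u).deriv) u₁ u₂
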